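/- arXiv:1312.5709 — 7 statements merged into one kernel-verified Lean document; each statement's English description precedes it below -/
import Mathlib

section
/- Let E and F be sets, let η : F → E be a map, let (𝒯ₙ)_{n∈ℕ} be a nonincreasing sequence of σ-algebras on E, and let D ⊆ F. For a σ-algebra 𝒮 on E write η⁻¹(𝒮) = {η⁻¹(C) : C ∈ 𝒮} (a σ-algebra on F), and for a subset D of F and a σ-algebra 𝒮 on F write D∩𝒮 = {D∩C : C ∈ 𝒮} (the trace σ-algebra on D). Then D ∩ η⁻¹(⋂ₙ 𝒯ₙ) = ⋂ₙ (D ∩ η⁻¹(𝒯ₙ)); in particular (taking D = F) η⁻¹(⋂ₙ 𝒯ₙ) = ⋂ₙ η⁻¹(𝒯ₙ). -/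
/-- Taking preimages of σ-algebras commutes with the infimum of an antitone sequence. -/
theorem MeasurableSpace.comap_iInf_of_antitone {α β : Type*} (f : α → β)
    {m : ℕ → MeasurableSpace β} (hm : Antitone m) :
    MeasurableSpace.comap f (⨅ n, m n) = ⨅ n, MeasurableSpace.comap f (m n) := by
  refine le_antisymm (le_iInf fun n => MeasurableSpace.comap_mono (iInf_le m n)) fun s hs => ?_
  choose C hC hCs using MeasurableSpace.measurableSet_iInf.1 hs
  refine ⟨Filter.limsup C Filter.atTop, MeasurableSpace.measurableSet_iInf.2 fun k => ?_, ?_⟩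
  · rw [← Filter.limsup_nat_add C k]
    exact @MeasurableSet.measurableSet_limsup β (m k) _
      fun n => hm (Nat.le_add_left k n) _ (hC (n + k))
  · ext x
    have hx : ∀ n, f x ∈ C n ↔ x ∈ s := fun n => by rw [← hCs n, Set.mem_preimage]
    simp only [Filter.limsup_eq_iInf_iSup_of_nat, Set.iInf_eq_iInter, Set.iSup_eq_iUnion,
      Set.mem_preimage, Set.mem_iInter, Set.mem_iUnion, hx, exists_prop, exists_and_right]
    exact ⟨fun h => (h 0).2, fun h n => ⟨⟨n, le_rfl⟩, h⟩⟩

/-- For a nonincreasing sequence of σ-algebras `𝒯 n` on `E`, a map `η : F → E`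
and a subset `D ⊆ F`, the trace on `D` of the preimage σ-algebra of the intersection
`⋂ₙ 𝒯ₙ` equals the intersection of the traces on `D` of the preimage σ-algebras; in
particular (taking `D = F`, i.e. without taking traces) the preimage σ-algebra of the
intersection is the intersection of the preimage σ-algebras.  Intersections of σ-algebras
are infima in the lattice of measurable space structures, preimages are `comap`s, and the
trace σ-algebra on `D` is the `comap` of the subtype inclusion. -/
theorem preimage_trace_iInf_sigmaAlgebras
    {E F : Type*} (η : F → E) (𝒯 : ℕ → MeasurableSpace E)
    (h𝒯 : ∀ m n : ℕ, m ≤ n → 𝒯 n ≤ 𝒯 m) (D : Set F) :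
    MeasurableSpace.comap (Subtype.val : D → F)
        (MeasurableSpace.comap η (⨅ n, 𝒯 n))
      = ⨅ n, MeasurableSpace.comap (Subtype.val : D → F)
          (MeasurableSpace.comap η (𝒯 n))
    ∧ MeasurableSpace.comap η (⨅ n, 𝒯 n) = ⨅ n, MeasurableSpace.comap η (𝒯 n) := by
  have h : Antitone 𝒯 := fun m n hmn => h𝒯 m n hmn
  refine ⟨?_, MeasurableSpace.comap_iInf_of_antitone η h⟩
  simp only [MeasurableSpace.comap_comp]
  exact MeasurableSpace.comap_iInf_of_antitone _ h
end

section
/- Let a : [0,∞) → [0,∞) be a right-continuous nondecreasing function and let μ_a be the Borel measure on [0,∞) determined by μ_a([0,u]) = a(u) for all u ≥ 0. Then for every t ≥ 0, ∫_{[0,t]} e^{−a(u)} dμ_a(u) ≤ 1 − e^{−a(t)}; in particular this integral is strictly less than 1. -/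
open MeasureTheory
open scoped NNReal ENNReal

/-- If `μ (Iic u) ≤ a u` for all `u`, then sublevel sets of a monotone `a` satisfy
`μ {a ≤ c} ≤ c`. -/
theorem measure_setOf_le_le {α : Type*} [LinearOrder α] [TopologicalSpace α] [OrderTopology α]
    [DenselyOrdered α] [TopologicalSpace.SeparableSpace α] [MeasurableSpace α]
    {a : α → ℝ≥0} (ha : Monotone a) {μ : Measure α}
    (hμ : ∀ u, μ (Set.Iic u) ≤ a u) (c : ℝ≥0) : μ {u | a u ≤ c} ≤ c := by
  by_cases hmax : ∃ m, IsGreatest {u | a u ≤ c} m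
  · obtain ⟨m, hm, hub⟩ := hmax
    exact (measure_mono fun u hu => hub hu).trans ((hμ m).trans (by exact_mod_cast hm))
  · obtain ⟨D, hDc, hD⟩ := TopologicalSpace.exists_countable_dense α
    have hsub : {u | a u ≤ c} ⊆ ⋃ q ∈ D ∩ {u | a u ≤ c}, Set.Iic q := by
      intro u hu
      obtain ⟨v, hv, huv⟩ : ∃ v, a v ≤ c ∧ u < v := by
        by_contra! h
        exact hmax ⟨u, hu, fun v hv => h v hv⟩
      obtain ⟨q, hqD, huq, hqv⟩ := hD.exists_between huv
      exact Set.mem_biUnion ⟨hqD, (ha hqv.le).trans hv⟩ huq.le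
    refine (measure_mono hsub).trans ?_
    rw [measure_biUnion_eq_iSup (hDc.mono Set.inter_subset_left)]
    · exact iSup₂_le fun q hq => (hμ q).trans (by exact_mod_cast hq.2)
    · intro p hp q hq
      rcases le_total p q with h | h
      · exact ⟨q, hq, Set.Iic_subset_Iic.2 h, subset_rfl⟩
      · exact ⟨p, hp, subset_rfl, Set.Iic_subset_Iic.2 h⟩

theorem lintegral_Ioc_exp_neg {A : ℝ} (hA : 0 ≤ A) :
    ∫⁻ s in Set.Ioc 0 A, ENNReal.ofReal (Real.exp (-s)) = ENNReal.ofReal (1 - Real.exp (-A)) := by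
  rw [← ofReal_integral_eq_lintegral_ofReal, ← intervalIntegral.integral_of_le hA]
  · simp
  · exact (by fun_prop : Continuous fun s : ℝ => Real.exp (-s)).integrableOn_Ioc
  · exact Filter.Eventually.of_forall fun s => (Real.exp_pos _).le

/-- Let `a : [0,∞) → [0,∞)` be right-continuous and nondecreasing and let
`μ` be the Borel measure on `[0,∞)` with `μ [0,u] = a u` (the Lebesgue–Stieltjes measure
of `a`, with an atom of mass `a 0` at `0`).  Then for every `t ≥ 0`,
`∫_[0,t] exp (-a u) dμ u ≤ 1 - exp (-a t)`; in particular this integral is `< 1`. -/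
theorem lintegral_exp_neg_stieltjes_le
    (a : ℝ≥0 → ℝ≥0) (ha_mono : Monotone a)
    (ha_rc : ∀ u : ℝ≥0, ContinuousWithinAt a (Set.Ici u) u)
    (μ : Measure ℝ≥0) (hμ : ∀ u : ℝ≥0, μ (Set.Iic u) = (a u : ℝ≥0∞)) :
    ∀ t : ℝ≥0,
      (∫⁻ u in Set.Iic t, ENNReal.ofReal (Real.exp (-(a u : ℝ))) ∂μ)
          ≤ ENNReal.ofReal (1 - Real.exp (-(a t : ℝ)))
      ∧ (∫⁻ u in Set.Iic t, ENNReal.ofReal (Real.exp (-(a u : ℝ))) ∂μ) < 1 := by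
  intro t
  have hle : (∫⁻ u in Set.Iic t, ENNReal.ofReal (Real.exp (-(a u : ℝ))) ∂μ)
      ≤ ENNReal.ofReal (1 - Real.exp (-(a t : ℝ))) := by
    have ham : Measurable a := ha_mono.measurable
    rw [← lintegral_Ioc_exp_neg (a t).coe_nonneg,
      lintegral_eq_lintegral_meas_le _ (Filter.Eventually.of_forall fun u => (Real.exp_pos _).le)
        (by fun_prop),
      lintegral_eq_lintegral_meas_le _ (Filter.Eventually.of_forall fun u => (Real.exp_pos _).le)
        (by fun_prop)]
    refine setLIntegral_mono' measurableSet_Ioi fun y hy => ?_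
    simp only [← Real.log_le_iff_le_exp (Set.mem_Ioi.1 hy), le_neg (a := Real.log y)]
    rcases lt_or_ge (-Real.log y) 0 with hc | hc
    · have : {u | (a u : ℝ) ≤ -Real.log y} = ∅ :=
        Set.eq_empty_of_forall_notMem fun u hu => (hc.trans_le (a u).coe_nonneg).not_ge hu
      simp [this]
    · lift -Real.log y to ℝ≥0 using hc with c
      simp only [NNReal.coe_le_coe]
      calc μ.restrict (Set.Iic t) {u | a u ≤ c} ≤ min (a t : ℝ≥0∞) c :=
            le_min ((measure_mono (Set.subset_univ _)).trans (by simp [hμ]))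
              ((Measure.restrict_apply_le _ _).trans
                (measure_setOf_le_le ha_mono (fun u => (hμ u).le) c))
        _ = volume (Set.Ioc (0 : ℝ) (a t) ∩ Set.Iic (c : ℝ)) := by
            rw [Set.Ioc_inter_Iic, Real.volume_Ioc, sub_zero, ENNReal.ofReal_min]
            simp
        _ = volume.restrict (Set.Ioc (0 : ℝ) (a t)) {s | s ≤ c} := by
            rw [Set.inter_comm, ← Measure.restrict_apply measurableSet_Iic]
            rfl
  refine ⟨hle, hle.trans_lt ?_⟩
  rw [ENNReal.ofReal_lt_one]
  linarith [Real.exp_pos (-(a t : ℝ))]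
end

section
/- Let A = (A_t)_{t∈[0,∞)} be an F-adapted process whose paths are right-continuous, nondecreasing, with values in [0,1], extended by A_∞ = 1, and for each ω let dA(ω) be the probability measure on [0,∞] with dA(ω)([0,u]) = A_u(ω) for u < ∞ (so dA(ω)({∞}) = 1 − lim_{t→∞}A_t(ω)). Then there exists a probability measure Q̌⁰ on (Ω×[0,∞], 𝒜⊗B([0,∞])), namely Q̌⁰[h] = ∫_Ω (∫_{[0,∞]} h(ω,v) dA_v(ω)) dQ(ω), such that (i) the image of Q̌⁰ under π equals Q on 𝒜, and (ii) for all 0 ≤ u ≤ t ≤ ∞, the map (ω,x) ↦ A_u(ω) is a version of E_{Q̌⁰}[1_{{τ̂≤u}} | F̌_t]. -/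
open MeasureTheory
open scoped ENNReal

/-- Let `A` be an `F`-adapted process with right-continuous nondecreasing
`[0,1]`-valued paths, extended by `A ∞ = 1`, and for each `ω` let `ν ω` be the probability
measure on `[0,∞]` with `ν ω [0,u] = A u ω`.  Then there is a probability measure `Q̌⁰` on
`Ω × [0,∞]` — namely `Q̌⁰[h] = ∫_Ω ∫_[0,∞] h (ω,v) d(ν ω) v dQ ω` — such that (i) its image
under `π = Prod.fst` is `Q` and (ii) for all `0 ≤ u ≤ t ≤ ∞` the map `(ω,x) ↦ A u ω` is a
version of `E_Q̌⁰[1_{τ̂ ≤ u} | F̌ t]`, where `τ̂ (ω,x) = x` and `F̌ t = π⁻¹ (F t)`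
(a Cox measure associated with `(Q, F, A, τ̂)`). -/
theorem exists_cox_measure
    {Ω : Type*} [𝒜 : MeasurableSpace Ω]
    (Q : Measure Ω) [IsProbabilityMeasure Q]
    (F : ℝ≥0∞ → MeasurableSpace Ω) (hF_le : ∀ t, F t ≤ 𝒜) (hF_mono : Monotone F)
    (A : ℝ≥0∞ → Ω → ℝ)
    (hA_adapted : ∀ t, @Measurable Ω ℝ (F t) _ (A t))
    (hA_mono : ∀ ω, Monotone fun t => A t ω)
    (hA_rc : ∀ ω, ∀ t : ℝ≥0∞, ContinuousWithinAt (fun s => A s ω) (Set.Ici t) t)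
    (hA_mem : ∀ t ω, A t ω ∈ Set.Icc (0 : ℝ) 1)
    (hA_top : ∀ ω, A ∞ ω = 1)
    (ν : Ω → Measure ℝ≥0∞) (hν_prob : ∀ ω, IsProbabilityMeasure (ν ω))
    (hν : ∀ ω, ∀ u : ℝ≥0∞, ν ω (Set.Iic u) = ENNReal.ofReal (A u ω)) :
    ∃ Q0 : Measure (Ω × ℝ≥0∞), IsProbabilityMeasure Q0 ∧
      (∀ h : Ω × ℝ≥0∞ → ℝ≥0∞, Measurable h →
        ∫⁻ p, h p ∂Q0 = ∫⁻ ω, ∫⁻ v, h (ω, v) ∂(ν ω) ∂Q) ∧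
      Measure.map Prod.fst Q0 = Q ∧
      (∀ u t : ℝ≥0∞, u ≤ t →
        (fun p : Ω × ℝ≥0∞ => A u p.1)
          =ᵐ[Q0] Q0[(fun p : Ω × ℝ≥0∞ => if p.2 ≤ u then (1 : ℝ) else 0)
            | (F t).comap Prod.fst]) := by
  have hκ : Measurable ν := by
    refine Measurable.measure_of_isPiSystem_of_isProbabilityMeasure
      (BorelSpace.measurable_eq.trans (borel_eq_generateFrom_Iic ℝ≥0∞)) isPiSystem_Iic ?_
    rintro _ ⟨u, rfl⟩
    simp_rw [hν]
    exact ((hA_adapted u).mono (hF_le u) le_rfl).ennreal_ofReal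
  let κ : ProbabilityTheory.Kernel Ω ℝ≥0∞ := ⟨ν, hκ⟩
  have : ProbabilityTheory.IsMarkovKernel κ := ⟨hν_prob⟩
  refine ⟨Q.compProd κ, inferInstance, fun h hh => Measure.lintegral_compProd hh,
    Measure.fst_compProd Q κ, fun u t hut => ?_⟩
  have hm : (F t).comap Prod.fst ≤ (inferInstance : MeasurableSpace (Ω × ℝ≥0∞)) :=
    (measurable_fst.mono le_rfl (hF_le t)).comap_le
  have hA : Measurable[(F t).comap Prod.fst] fun p : Ω × ℝ≥0∞ => A u p.1 :=
    ((hA_adapted u).mono (hF_mono hut) le_rfl).comp (comap_measurable Prod.fst)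
  have hA_int : Integrable (fun p : Ω × ℝ≥0∞ => A u p.1) (Q.compProd κ) :=
    Integrable.of_bound (hA.mono hm le_rfl).aestronglyMeasurable 1 (.of_forall fun p => by
      rw [Real.norm_of_nonneg (hA_mem u p.1).1]; exact (hA_mem u p.1).2)
  have hind_meas : Measurable fun p : Ω × ℝ≥0∞ => if p.2 ≤ u then (1 : ℝ) else 0 :=
    Measurable.ite (measurable_snd measurableSet_Iic) measurable_const measurable_const
  have hind_int : Integrable (fun p : Ω × ℝ≥0∞ => if p.2 ≤ u then (1 : ℝ) else 0)
      (Q.compProd κ) :=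
    Integrable.of_bound hind_meas.aestronglyMeasurable 1 (.of_forall fun p => by
      split_ifs <;> simp)
  refine ae_eq_condExp_of_forall_setIntegral_eq hm hind_int (fun _ _ _ => hA_int.integrableOn)
    ?_ hA.stronglyMeasurable.aestronglyMeasurable
  rintro _ ⟨B, hB, rfl⟩ -
  rw [← Set.prod_univ, Measure.setIntegral_compProd (hF_le t B hB) .univ hA_int.integrableOn,
    Measure.setIntegral_compProd (hF_le t B hB) .univ hind_int.integrableOn]
  refine integral_congr_ae (.of_forall fun ω => ?_)
  have hind : (fun v : ℝ≥0∞ => if v ≤ u then (1 : ℝ) else 0) = (Set.Iic u).indicator 1 := by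
    ext v; simp [Set.indicator_apply]
  have hreal : (κ ω).real (Set.Iic u) = A u ω := by
    rw [measureReal_def, show κ ω = ν ω from rfl, hν, ENNReal.toReal_ofReal (hA_mem u ω).1]
  simp [hind, integral_indicator_one measurableSet_Iic, hreal]
end

section
/- Let (M^u : u ∈ [0,∞]) be a complete iM(Q,F) family: M^u_t(ω) ∈ [0,1] is jointly measurable, for every u ∈ [0,∞] the process (M^u_t)_{t∈[0,∞]} satisfies M^u_t = E_Q[M^u_∞ | F_t] a.s. for all t, for every (t,ω) the map u ↦ M^u_t(ω) is right-continuous and nondecreasing on [0,∞], and M^∞_∞ = 1. Then there exists a unique probability measure Q' on (Ω×[0,∞], 𝒜⊗B([0,∞])) such that: (i) the image of Q' under π equals Q on 𝒜; (ii) for all 0 ≤ u ≤ t ≤ ∞, M^u_t∘π is a version of E_{Q'}[1_{{τ̂≤u}} | F̌_t]; and (iii) for all u ∈ [0,∞], M^u_∞∘π is a version of E_{Q'}[1_{{τ̂≤u}} | π⁻¹(𝒜)]. -/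
open MeasureTheory
open scoped ENNReal

/-- If `u ↦ g u` is nondecreasing and right-continuous, its generalized inverse
`sInf {v | x ≤ g v}` is characterized by the Galois relation with `g`. -/
theorem sInf_le_iff_le_of_monotone_of_rightContinuous {g : ℝ≥0∞ → ℝ} (hg : Monotone g)
    (hrc : ∀ u, ContinuousWithinAt g (Set.Ici u) u) {x : ℝ} (hx : x ≤ g ∞) (u : ℝ≥0∞) :
    sInf {v | x ≤ g v} ≤ u ↔ x ≤ g u := by
  refine ⟨fun h => ?_, fun h => sInf_le h⟩
  have hne : {v | x ≤ g v}.Nonempty := ⟨∞, hx⟩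
  refine le_trans ?_ (hg h)
  have hglb := isGLB_sInf {v | x ≤ g v}
  have hcl := hglb.mem_closure hne
  have : (nhdsWithin (sInf {v | x ≤ g v}) {v | x ≤ g v}).NeBot :=
    mem_closure_iff_nhdsWithin_neBot.mp hcl
  have ht := (hrc (sInf {v | x ≤ g v})).mono_left
    (nhdsWithin_mono _ (fun v hv => sInf_le hv) :
      nhdsWithin (sInf {v | x ≤ g v}) {v | x ≤ g v} ≤ _)
  exact ge_of_tendsto ht self_mem_nhdsWithin

/-- A finite measure on `Ω × [0,∞]` is determined by its values on the sets `S × [0,u]`. -/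
theorem measure_prod_ext_of_Iic {Ω : Type*} [MeasurableSpace Ω] {μ ν : Measure (Ω × ℝ≥0∞)}
    [IsFiniteMeasure μ] [IsFiniteMeasure ν]
    (h : ∀ S : Set Ω, MeasurableSet S → ∀ u : ℝ≥0∞, μ (S ×ˢ Set.Iic u) = ν (S ×ˢ Set.Iic u)) :
    μ = ν := by
  refine Measure.ext_prod fun {S T} hS hT => ?_
  have key : ∀ (ρ : Measure (Ω × ℝ≥0∞)) (A : Set ℝ≥0∞), MeasurableSet A →
      ((ρ.restrict (Prod.fst ⁻¹' S)).map Prod.snd) A = ρ (S ×ˢ A) := fun ρ A hA => by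
    rw [Measure.map_apply measurable_snd hA, Measure.restrict_apply (measurable_snd hA),
      Set.inter_comm, Set.prod_eq]
  have heq : (μ.restrict (Prod.fst ⁻¹' S)).map Prod.snd
      = (ν.restrict (Prod.fst ⁻¹' S)).map Prod.snd :=
    Measure.ext_of_Iic _ _ fun u => by
      rw [key μ _ measurableSet_Iic, key ν _ measurableSet_Iic, h S hS u]
  rw [← key μ T hT, ← key ν T hT, heq]

theorem setIntegral_ite_snd_le {Ω : Type*} [MeasurableSpace Ω] (μ : Measure (Ω × ℝ≥0∞))
    (S : Set Ω) (u : ℝ≥0∞) :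
    ∫ p in Prod.fst ⁻¹' S, (if p.2 ≤ u then (1 : ℝ) else 0) ∂μ = μ.real (S ×ˢ Set.Iic u) := by
  have hA : MeasurableSet {p : Ω × ℝ≥0∞ | p.2 ≤ u} := measurable_snd measurableSet_Iic
  have : (fun p : Ω × ℝ≥0∞ => if p.2 ≤ u then (1 : ℝ) else 0)
      = {p : Ω × ℝ≥0∞ | p.2 ≤ u}.indicator 1 := by
    ext p; simp [Set.indicator_apply]
  rw [this, integral_indicator_one hA, measureReal_restrict_apply hA, Set.inter_comm]
  rfl

theorem integrable_ite_snd_le {Ω : Type*} [MeasurableSpace Ω] (μ : Measure (Ω × ℝ≥0∞))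
    [IsFiniteMeasure μ] (u : ℝ≥0∞) :
    Integrable (fun p : Ω × ℝ≥0∞ => if p.2 ≤ u then (1 : ℝ) else 0) μ := by
  have hA : MeasurableSet {p : Ω × ℝ≥0∞ | p.2 ≤ u} := measurable_snd measurableSet_Iic
  refine Integrable.of_bound
    (Measurable.ite hA measurable_const measurable_const).aestronglyMeasurable 1
    (Filter.Eventually.of_forall fun p => ?_)
  split_ifs <;> simp

/-- A function on `Ω` is a version of the conditional probability of `{τ̂ ≤ u}` given the
pullback of a sub-σ-algebra `m` if it has the right integrals over the sets of `m`. -/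
theorem comp_fst_ae_eq_condExp_ite_snd_le {Ω : Type*} {m 𝒜 : MeasurableSpace Ω} (hm : m ≤ 𝒜)
    (μ : Measure (Ω × ℝ≥0∞)) [IsFiniteMeasure μ] {g : Ω → ℝ} {u : ℝ≥0∞}
    (hg : Integrable g (μ.map Prod.fst)) (hgm : AEStronglyMeasurable[m] g (μ.map Prod.fst))
    (h : ∀ S : Set Ω, MeasurableSet[m] S →
      ∫ ω in S, g ω ∂(μ.map Prod.fst) = μ.real (S ×ˢ Set.Iic u)) :
    (fun p : Ω × ℝ≥0∞ => g p.1) =ᵐ[μ]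
      μ[(fun p : Ω × ℝ≥0∞ => if p.2 ≤ u then (1 : ℝ) else 0) | m.comap Prod.fst] := by
  have hle : m.comap (Prod.fst : Ω × ℝ≥0∞ → Ω) ≤ 𝒜.prod inferInstance :=
    (MeasurableSpace.comap_mono hm).trans measurable_fst.comap_le
  refine ae_eq_condExp_of_forall_setIntegral_eq hle (integrable_ite_snd_le μ u)
    (fun s _ _ => (hg.comp_measurable measurable_fst).integrableOn) ?_ ?_
  · rintro _ ⟨S, hS, rfl⟩ -
    rw [setIntegral_ite_snd_le, ← h S hS,
      setIntegral_map (hm _ hS) hg.aestronglyMeasurable measurable_fst.aemeasurable]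
  · obtain ⟨g', hg', hgg'⟩ := hgm
    exact ⟨fun p => g' p.1, hg'.comp_measurable (comap_measurable _),
      ae_of_ae_map measurable_fst.aemeasurable hgg'⟩

/-- The integrals of a version of the conditional probability of `{τ̂ ≤ u}` given `π⁻¹ 𝒜`. -/
theorem setIntegral_of_comp_fst_ae_eq_condExp {Ω : Type*} [𝒜 : MeasurableSpace Ω]
    (μ : Measure (Ω × ℝ≥0∞)) [IsFiniteMeasure μ] {g : Ω → ℝ} {u : ℝ≥0∞} (hg : Measurable g)
    (h : (fun p : Ω × ℝ≥0∞ => g p.1) =ᵐ[μ]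
      μ[(fun p : Ω × ℝ≥0∞ => if p.2 ≤ u then (1 : ℝ) else 0) |
        MeasurableSpace.comap Prod.fst 𝒜])
    {S : Set Ω} (hS : MeasurableSet S) :
    μ.real (S ×ˢ Set.Iic u) = ∫ ω in S, g ω ∂(μ.map Prod.fst) := by
  rw [setIntegral_map hS hg.aestronglyMeasurable measurable_fst.aemeasurable,
    setIntegral_congr_ae (measurable_fst hS) (h.mono fun p hp _ => hp),
    setIntegral_condExp measurable_fst.comap_le (integrable_ite_snd_le μ u) ⟨S, hS, rfl⟩,
    setIntegral_ite_snd_le]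

/-- Existence of a probability measure with first marginal `Q` and conditional distribution
function `G`, built by inverting `G` at an independent uniform variable. -/
theorem exists_measure_prod_Iic_eq_setIntegral {Ω : Type*} [MeasurableSpace Ω]
    (Q : Measure Ω) [IsProbabilityMeasure Q] (G : ℝ≥0∞ → Ω → ℝ)
    (hG_meas : ∀ u, Measurable (G u)) (hG_mem : ∀ u ω, G u ω ∈ Set.Icc (0 : ℝ) 1)
    (hG_mono : ∀ ω, Monotone fun u => G u ω)
    (hG_rc : ∀ ω, ∀ u : ℝ≥0∞, ContinuousWithinAt (fun v => G v ω) (Set.Ici u) u)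
    (hG_one : ∀ ω, G ∞ ω = 1) :
    ∃ μ : Measure (Ω × ℝ≥0∞), IsProbabilityMeasure μ ∧ μ.map Prod.fst = Q ∧
      ∀ (S : Set Ω) (u : ℝ≥0∞), MeasurableSet S →
        ∫ ω in S, G u ω ∂Q = μ.real (S ×ˢ Set.Iic u) := by
  let T : Ω × unitInterval → ℝ≥0∞ := fun p => sInf {v | (p.2 : ℝ) ≤ G v p.1}
  have hT : ∀ p u, T p ≤ u ↔ (p.2 : ℝ) ≤ G u p.1 := fun p u =>
    sInf_le_iff_le_of_monotone_of_rightContinuous (hG_mono p.1) (hG_rc p.1)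
      (by rw [hG_one]; exact p.2.2.2) u
  have hT_meas : Measurable T := measurable_of_Iic fun u => by
    have : T ⁻¹' Set.Iic u = {p | (p.2 : ℝ) ≤ G u p.1} := by ext p; exact hT p u
    rw [this]
    exact measurableSet_le (measurable_subtype_coe.comp measurable_snd)
      ((hG_meas u).comp measurable_fst)
  have hφ : Measurable fun p : Ω × unitInterval => (p.1, T p) := measurable_fst.prodMk hT_meas
  refine ⟨(Q.prod volume).map fun p => (p.1, T p), Measure.isProbabilityMeasure_map
    hφ.aemeasurable, ?_, fun S u hS => ?_⟩
  · rw [Measure.map_map measurable_fst hφ]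
    exact Measure.fst_prod
  · have hSu : MeasurableSet (S ×ˢ Set.Iic u) := hS.prod measurableSet_Iic
    rw [measureReal_def, Measure.map_apply hφ hSu, Measure.prod_apply (hφ hSu),
      integral_eq_lintegral_of_nonneg_ae (Filter.Eventually.of_forall fun ω => (hG_mem u ω).1)
        (hG_meas u).aestronglyMeasurable, ← lintegral_indicator hS]
    congr 1
    refine lintegral_congr fun ω => ?_
    by_cases hω : ω ∈ S
    · have : Prod.mk ω ⁻¹' ((fun p : Ω × unitInterval => (p.1, T p)) ⁻¹' (S ×ˢ Set.Iic u))
          = Set.Iic (⟨G u ω, hG_mem u ω⟩ : unitInterval) := by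
        ext x
        simp [hω, hT, ← Subtype.coe_le_coe]
      rw [this, unitInterval.volume_Iic, Set.indicator_of_mem hω]
    · have : Prod.mk ω ⁻¹' ((fun p : Ω × unitInterval => (p.1, T p)) ⁻¹' (S ×ˢ Set.Iic u)) = ∅ := by
        ext x
        simp [hω]
      rw [this, measure_empty, Set.indicator_of_notMem hω]

/-- Let `(M u t)_{u,t ∈ [0,∞]}` be a complete iM(Q,F) family: jointly
measurable with values in `[0,1]`, `M u · ` is a martingale (`M u t = E_Q[M u ∞ | F t]`
a.s.), `u ↦ M u t ω` is right-continuous and nondecreasing, and `M ∞ ∞ = 1`.  Then there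
is a unique probability measure `Q'` on `Ω × [0,∞]` such that (i) its image under
`π = Prod.fst` is `Q`, (ii) for `0 ≤ u ≤ t ≤ ∞`, `M u t ∘ π` is a version of
`E_Q'[1_{τ̂ ≤ u} | F̌ t]`, and (iii) for all `u`, `M u ∞ ∘ π` is a version of
`E_Q'[1_{τ̂ ≤ u} | π⁻¹ 𝒜]`, where `τ̂ (ω,x) = x` and `F̌ t = π⁻¹ (F t)`. -/
theorem existsUnique_measure_of_iM
    {Ω : Type*} [𝒜 : MeasurableSpace Ω]
    (Q : Measure Ω) [IsProbabilityMeasure Q]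
    (F : ℝ≥0∞ → MeasurableSpace Ω) (hF_le : ∀ t, F t ≤ 𝒜) (hF_mono : Monotone F)
    (hF_top : F ∞ = ⨆ (t : ℝ≥0∞) (_ : t ≠ ∞), F t)
    (M : ℝ≥0∞ → ℝ≥0∞ → Ω → ℝ)
    (hM_meas : Measurable fun q : (ℝ≥0∞ × ℝ≥0∞) × Ω => M q.1.1 q.1.2 q.2)
    (hM_mem : ∀ u t ω, M u t ω ∈ Set.Icc (0 : ℝ) 1)
    (hM_mart : ∀ u t : ℝ≥0∞, M u t =ᵐ[Q] Q[M u ∞ | F t])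
    (hM_mono : ∀ t ω, Monotone fun u => M u t ω)
    (hM_rc : ∀ t ω, ∀ u : ℝ≥0∞, ContinuousWithinAt (fun v => M v t ω) (Set.Ici u) u)
    (hM_one : ∀ ω, M ∞ ∞ ω = 1) :
    ∃! Q' : Measure (Ω × ℝ≥0∞), IsProbabilityMeasure Q' ∧
      Measure.map Prod.fst Q' = Q ∧
      (∀ u t : ℝ≥0∞, u ≤ t →
        (fun p : Ω × ℝ≥0∞ => M u t p.1)
          =ᵐ[Q'] Q'[(fun p : Ω × ℝ≥0∞ => if p.2 ≤ u then (1 : ℝ) else 0)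
            | (F t).comap Prod.fst]) ∧
      (∀ u : ℝ≥0∞,
        (fun p : Ω × ℝ≥0∞ => M u ∞ p.1)
          =ᵐ[Q'] Q'[(fun p : Ω × ℝ≥0∞ => if p.2 ≤ u then (1 : ℝ) else 0)
            | MeasurableSpace.comap Prod.fst 𝒜]) := by
  have hMu : ∀ u t, Measurable (M u t) := fun u t =>
    hM_meas.comp (measurable_prodMk_left (x := (u, t)))
  have hMi : ∀ u t, Integrable (M u t) Q := fun u t =>
    Integrable.of_bound (hMu u t).aestronglyMeasurable 1 (Filter.Eventually.of_forall fun ω => by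
      rw [Real.norm_of_nonneg (hM_mem u t ω).1]; exact (hM_mem u t ω).2)
  obtain ⟨μ, hμ, rfl, hμS⟩ := exists_measure_prod_Iic_eq_setIntegral Q (fun u => M u ∞)
    (fun u => hMu u ∞) (fun u => hM_mem u ∞) (hM_mono ∞) (hM_rc ∞) hM_one
  refine ⟨μ, ⟨hμ, rfl, fun u t _ => ?_, fun u => ?_⟩, ?_⟩
  · refine comp_fst_ae_eq_condExp_ite_snd_le (hF_le t) μ (hMi u t)
      ⟨_, stronglyMeasurable_condExp, hM_mart u t⟩ fun S hS => ?_
    rw [← hμS S u (hF_le t _ hS),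
      setIntegral_congr_ae (hF_le t _ hS) ((hM_mart u t).mono fun ω hω _ => hω),
      setIntegral_condExp (hF_le t) (hMi u ∞) hS]
  · exact comp_fst_ae_eq_condExp_ite_snd_le le_rfl μ (hMi u ∞) (hMi u ∞).aestronglyMeasurable
      fun S hS => hμS S u hS
  · rintro ν ⟨hν, hν_map, -, hν_cond⟩
    refine measure_prod_ext_of_Iic fun S hS u => ?_
    rw [← measureReal_eq_measureReal_iff, ← hμS S u hS, ← hν_map]
    exact setIntegral_of_comp_fst_ae_eq_condExp ν (hMu u ∞) (hν_cond u) hS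
end

section
/- Fix t ∈ [0,∞). If the restriction of Q̌ to the σ-algebra F̌_t ∨ σ(τ̂∤t) is absolutely continuous with respect to the restriction of the Cox measure Q̌⁰ to F̌_t ∨ σ(τ̂∤t), then the conditional distribution of τ is differentiable at t with respect to A: there exists a nonnegative F_t⊗B([0,∞])-measurable function p_t on Ω×[0,∞] such that for every u ∈ [0,t], the random variable ω ↦ ∫_{[0,u]} p_t(ω,v) dA_v(ω) is a version of Q[τ ≤ u | F_t]. -/
open MeasureTheory
open scoped ENNReal

/-- The operation `a ∤ b`: equals `a` if `a ≤ b` and `∞` otherwise. -/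
noncomputable def nmid (a b : ℝ≥0∞) : ℝ≥0∞ := if a ≤ b then a else ∞

/-- Absolute continuity on a sub-σ-algebra gives a real density measurable for it. -/
theorem exists_density_of_absolutelyContinuous_sub {X : Type*} {m m0 : MeasurableSpace X}
    (hm : m ≤ m0) (μ ρ : Measure X) [IsFiniteMeasure μ] [IsFiniteMeasure ρ]
    (h : ∀ s, MeasurableSet[m] s → ρ s = 0 → μ s = 0) :
    ∃ f : X → ℝ, (∀ x, 0 ≤ f x) ∧ Measurable[m] f ∧
      ∀ s, MeasurableSet[m] s → ∫⁻ x in s, ENNReal.ofReal (f x) ∂ρ = μ s := by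
  have hac : μ.trim hm ≪ ρ.trim hm := by
    refine Measure.AbsolutelyContinuous.mk fun s hs h0 => ?_
    rw [trim_measurableSet_eq hm hs] at h0 ⊢
    exact h s hs h0
  have hmeas : Measurable[m] ((μ.trim hm).rnDeriv (ρ.trim hm)) := Measure.measurable_rnDeriv _ _
  refine ⟨fun x => ((μ.trim hm).rnDeriv (ρ.trim hm) x).toReal, fun _ => ENNReal.toReal_nonneg,
    hmeas.ennreal_toReal, fun s hs => ?_⟩
  have hfin : ∀ᵐ x ∂ρ.trim hm, ENNReal.ofReal ((μ.trim hm).rnDeriv (ρ.trim hm) x).toReal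
      = (μ.trim hm).rnDeriv (ρ.trim hm) x := by
    filter_upwards [Measure.rnDeriv_lt_top (μ.trim hm) (ρ.trim hm)] with x hx
    exact ENNReal.ofReal_toReal hx.ne
  rw [lintegral_congr_ae (ae_restrict_of_ae (ae_of_ae_trim hm hfin)),
    ← setLIntegral_trim hm hmeas hs, Measure.setLIntegral_rnDeriv hac, trim_measurableSet_eq hm hs]

/-- Parametric integrals over `[0, u]` are measurable as soon as the distribution functions are
measurable up to `u`. -/
theorem measurable_setLIntegral_Iic {Ω : Type*} [MeasurableSpace Ω] {ν : Ω → Measure ℝ≥0∞}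
    (hν : ∀ ω, IsProbabilityMeasure (ν ω)) {u : ℝ≥0∞}
    (h : ∀ s ≤ u, Measurable fun ω => ν ω (Set.Iic s))
    {f : Ω × ℝ≥0∞ → ℝ≥0∞} (hf : Measurable f) :
    Measurable fun ω => ∫⁻ v in Set.Iic u, f (ω, v) ∂(ν ω) := by
  have hκ : Measurable fun ω => (ν ω).restrict (Set.Iic u) := by
    refine Measurable.measure_of_isPiSystem (S := Set.range Set.Iic)
      (by rw [← borel_eq_generateFrom_Iic]; exact BorelSpace.measurable_eq) isPiSystem_Iic ?_ ?_
    · rintro _ ⟨s, rfl⟩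
      simp only [Measure.restrict_apply measurableSet_Iic, Set.Iic_inter_Iic]
      exact h _ inf_le_right
    · simpa using h u le_rfl
  let κ : ProbabilityTheory.Kernel Ω ℝ≥0∞ := ⟨fun ω => (ν ω).restrict (Set.Iic u), hκ⟩
  have : ProbabilityTheory.IsFiniteKernel κ :=
    ⟨1, ENNReal.one_lt_top, fun ω => (Measure.restrict_apply_univ _).trans_le prob_le_one⟩
  exact hf.lintegral_kernel_prod_right' (κ := κ)

/-- A version of a conditional probability is recognised by its integrals over sets of the
σ-algebra. -/
theorem toReal_ae_eq_condExp_indicator {Ω : Type*} {m m0 : MeasurableSpace Ω} (hm : m ≤ m0)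
    {μ : Measure Ω} [IsFiniteMeasure μ] {g : Ω → ℝ≥0∞} (hg : Measurable[m] g)
    {p : Ω → Prop} [DecidablePred p] (hp : MeasurableSet {ω | p ω})
    (h : ∀ B, MeasurableSet[m] B → ∫⁻ ω in B, g ω ∂μ = μ (B ∩ {ω | p ω})) :
    (fun ω => (g ω).toReal) =ᵐ[μ] μ[(fun ω => if p ω then (1 : ℝ) else 0) | m] := by
  have hg0 : Measurable g := hg.mono hm le_rfl
  have hfin : ∫⁻ ω, g ω ∂μ ≠ ∞ := by
    have := h Set.univ MeasurableSet.univ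
    rw [setLIntegral_univ] at this
    rw [this]
    exact measure_ne_top _ _
  have h_int : Integrable (fun ω => (g ω).toReal) μ :=
    integrable_toReal_of_lintegral_ne_top hg0.aemeasurable hfin
  have hind : (fun ω => if p ω then (1 : ℝ) else 0) = {ω | p ω}.indicator fun _ => 1 := by
    ext ω; simp [Set.indicator]
  rw [hind]
  refine ae_eq_condExp_of_forall_setIntegral_eq hm ((integrable_const 1).indicator hp)
    (fun _ _ _ => h_int.integrableOn) (fun B hB _ => ?_)
    hg.ennreal_toReal.stronglyMeasurable.aestronglyMeasurable
  rw [integral_toReal hg0.aemeasurable (ae_restrict_of_ae (ae_lt_top hg0 hfin)), h B hB,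
    setIntegral_indicator hp]
  simp [Measure.real]

/-- Fix `t ∈ [0,∞)`.  If `Q̌ = φ_* Q` (with `φ ω = (ω, τ ω)`) is absolutely
continuous with respect to the Cox measure `Q̌⁰` on the σ-algebra `F̌ t ∨ σ(τ̂ ∤ t)`
(every `F̌ t ∨ σ(τ̂ ∤ t)`-measurable `Q̌⁰`-null set is `Q̌`-null), then the conditional
distribution of `τ` is differentiable at `t` with respect to `A`: there is a nonnegative
`F_t ⊗ B([0,∞])`-measurable `p_t` on `Ω × [0,∞]` such that for every `u ≤ t`,
`ω ↦ ∫_[0,u] p_t (ω,v) d(ν ω) v` is a version of `Q[τ ≤ u | F t]`, where `ν ω` is the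
probability measure on `[0,∞]` with `ν ω [0,u] = A u ω`. -/
theorem absolutelyContinuous_cox_differentiable_iM
    {Ω : Type*} [𝒜 : MeasurableSpace Ω]
    (Q : Measure Ω) [IsProbabilityMeasure Q]
    (F : ℝ≥0∞ → MeasurableSpace Ω) (hF_le : ∀ t, F t ≤ 𝒜) (hF_mono : Monotone F)
    (τ : Ω → ℝ≥0∞) (hτ : Measurable τ)
    (A : ℝ≥0∞ → Ω → ℝ)
    (hA_adapted : ∀ t, @Measurable Ω ℝ (F t) _ (A t))
    (hA_mono : ∀ ω, Monotone fun t => A t ω)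
    (hA_rc : ∀ ω, ∀ t : ℝ≥0∞, ContinuousWithinAt (fun s => A s ω) (Set.Ici t) t)
    (hA_mem : ∀ (t : ℝ≥0∞) (ω), t ≠ ∞ → A t ω ∈ Set.Ico (0 : ℝ) 1)
    (hA_top : ∀ ω, A ∞ ω = 1)
    (ν : Ω → Measure ℝ≥0∞) (hν_prob : ∀ ω, IsProbabilityMeasure (ν ω))
    (hν : ∀ ω, ∀ u : ℝ≥0∞, ν ω (Set.Iic u) = ENNReal.ofReal (A u ω))
    -- the Cox measure `Q̌⁰` associated with `(Q, F, A, τ̂)`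
    (Q0 : Measure (Ω × ℝ≥0∞))
    (hQ0 : ∀ h : Ω × ℝ≥0∞ → ℝ≥0∞, Measurable h →
      ∫⁻ p, h p ∂Q0 = ∫⁻ ω, ∫⁻ v, h (ω, v) ∂(ν ω) ∂Q)
    (t : ℝ≥0∞) (ht : t ≠ ∞)
    (hac : ∀ s : Set (Ω × ℝ≥0∞),
      MeasurableSet[(F t).comap Prod.fst ⊔
        MeasurableSpace.comap (fun p : Ω × ℝ≥0∞ => nmid p.2 t)
          (inferInstance : MeasurableSpace ℝ≥0∞)] s →
      Q0 s = 0 → Measure.map (fun ω => (ω, τ ω)) Q s = 0) :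
    ∃ pt : Ω × ℝ≥0∞ → ℝ, (∀ p, 0 ≤ pt p) ∧
      (@Measurable (Ω × ℝ≥0∞) ℝ
        ((F t).prod (inferInstance : MeasurableSpace ℝ≥0∞)) _ pt) ∧
      (∀ u : ℝ≥0∞, u ≤ t →
        (fun ω => (∫⁻ v in Set.Iic u, ENNReal.ofReal (pt (ω, v)) ∂(ν ω)).toReal)
          =ᵐ[Q] Q[(fun ω => if τ ω ≤ u then (1 : ℝ) else 0) | F t]) := by
  have hG : (F t).comap Prod.fst ⊔ MeasurableSpace.comap (fun p : Ω × ℝ≥0∞ => nmid p.2 t)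
      (inferInstance : MeasurableSpace ℝ≥0∞) ≤ (F t).prod inferInstance :=
    sup_le_sup le_rfl ((Measurable.ite measurableSet_Iic measurable_id measurable_const).comp
      (comap_measurable Prod.snd)).comap_le
  have hprod : (F t).prod (inferInstance : MeasurableSpace ℝ≥0∞) ≤ 𝒜.prod inferInstance :=
    sup_le_sup (MeasurableSpace.comap_mono (hF_le t)) le_rfl
  have hφ : Measurable fun ω => (ω, τ ω) := measurable_id.prodMk hτ
  have : IsFiniteMeasure Q0 := ⟨by
    have h1 : Q0 Set.univ = 1 := by simpa using hQ0 1 measurable_one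
    simp [h1]⟩
  obtain ⟨pt, hpt0, hptm, hpt⟩ :=
    exists_density_of_absolutelyContinuous_sub (hG.trans hprod) _ Q0 hac
  refine ⟨pt, hpt0, hptm.mono hG le_rfl, fun u hu => ?_⟩
  refine toReal_ae_eq_condExp_indicator (hF_le t) ?_ (hτ measurableSet_Iic) fun B hB => ?_
  · refine @measurable_setLIntegral_Iic Ω (F t) ν hν_prob u (fun s hs => ?_)
      (fun p => ENNReal.ofReal (pt p)) (hptm.mono hG le_rfl).ennreal_ofReal
    simp only [hν]
    exact ((hA_adapted s).mono (hF_mono (hs.trans hu)) le_rfl).ennreal_ofReal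
  · have hS : MeasurableSet[(F t).comap Prod.fst ⊔
        MeasurableSpace.comap (fun p : Ω × ℝ≥0∞ => nmid p.2 t) inferInstance]
        (B ×ˢ Set.Iic u) := by
      have hIic : (Prod.snd ⁻¹' Set.Iic u : Set (Ω × ℝ≥0∞))
          = (fun p => nmid p.2 t) ⁻¹' Set.Iic u := by
        ext p
        simp only [Set.mem_preimage, Set.mem_Iic, nmid]
        split_ifs with hp
        · rfl
        · exact iff_of_false (fun h => hp (h.trans hu))
            (fun h => ht (top_le_iff.mp (h.trans hu)))
      rw [Set.prod_eq, hIic]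
      exact MeasurableSet.inter (le_sup_left (α := MeasurableSpace _) _ ⟨B, hB, rfl⟩)
        (le_sup_right (α := MeasurableSpace _) _ ⟨Set.Iic u, measurableSet_Iic, rfl⟩)
    have hS0 : MeasurableSet (B ×ˢ Set.Iic u) := (hG.trans hprod) _ hS
    have hpt' : Measurable fun p => ENNReal.ofReal (pt p) :=
      (hptm.mono (hG.trans hprod) le_rfl).ennreal_ofReal
    have key := hpt _ hS
    rw [Measure.map_apply hφ hS0, ← lintegral_indicator hS0,
      hQ0 _ (hpt'.indicator hS0)] at key
    rw [← lintegral_indicator (hF_le t _ hB)]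
    refine (lintegral_congr fun ω => ?_).trans key
    by_cases hω : ω ∈ B
    · rw [Set.indicator_of_mem hω, ← lintegral_indicator measurableSet_Iic]
      refine lintegral_congr fun v => ?_
      simp [Set.indicator, hω]
    · simp [Set.indicator, hω]
end

section
/- Fix t ∈ [0,∞) and suppose the conditional distribution of τ is differentiable at t with respect to A with density p_t. Then Q[{ω : τ(ω) ≤ t and p_t(ω,τ(ω)) = 0}] = 0; equivalently, Q-almost surely on the event {τ ≤ t} one has p_t(·,τ) > 0. -/
open MeasureTheory
open scoped ENNReal

section
open ProbabilityTheory

/-- If a finite measure on `Ω × ℝ≥0∞` agrees on rectangles `G × [0, u]` with the composition of `P`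
and the kernel `κ` weighted by `f`, then it gives no mass to the zero set of `f`. -/
theorem measure_zeroSet_eq_zero_of_prod_Iic {Ω : Type*} [MeasurableSpace Ω]
    (P : Measure Ω) [SFinite P] (κ : Kernel Ω ℝ≥0∞) [IsSFiniteKernel κ]
    (f : Ω → ℝ≥0∞ → ℝ≥0∞) (hf : Measurable (Function.uncurry f)) (hf_top : ∀ a b, f a b ≠ ∞)
    (μ : Measure (Ω × ℝ≥0∞)) [IsFiniteMeasure μ]
    (h : ∀ G, MeasurableSet G → ∀ u : ℝ≥0∞,
      μ (G ×ˢ Set.Iic u) = ∫⁻ ω in G, ∫⁻ v in Set.Iic u, f ω v ∂κ ω ∂P) :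
    μ {p | f p.1 p.2 = 0} = 0 := by
  have : IsSFiniteKernel (κ.withDensity f) := Kernel.IsSFiniteKernel.withDensity κ hf_top
  have hrect : ∀ G, MeasurableSet G → ∀ u : ℝ≥0∞,
      μ (G ×ˢ Set.Iic u) = (P ⊗ₘ κ.withDensity f) (G ×ˢ Set.Iic u) := fun G hG u => by
    rw [h G hG u, Measure.compProd_apply_prod hG measurableSet_Iic]
    simp_rw [Kernel.withDensity_apply' κ hf]
  have hμ : μ = P ⊗ₘ κ.withDensity f := by
    refine ext_of_generate_finite
      (Set.image2 (· ×ˢ ·) {s : Set Ω | MeasurableSet s} (Set.range Set.Iic)) ?_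
      (MeasurableSpace.isPiSystem_measurableSet.prod isPiSystem_Iic) ?_ ?_
    · refine (generateFrom_eq_prod (D := Set.range Set.Iic)
        MeasurableSpace.generateFrom_measurableSet ?_
        isCountablySpanning_measurableSet
        ⟨fun _ => Set.univ, fun _ => ⟨⊤, Set.Iic_top⟩, Set.iUnion_const _⟩).symm
      rw [← borel_eq_generateFrom_Iic, ← BorelSpace.measurable_eq]
    · rintro _ ⟨G, hG, _, ⟨u, rfl⟩, rfl⟩
      exact hrect G hG u
    · have := hrect Set.univ .univ ⊤
      rwa [Set.Iic_top, Set.univ_prod_univ] at this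
  have hmeas : MeasurableSet {p : Ω × ℝ≥0∞ | f p.1 p.2 = 0} := hf (measurableSet_singleton 0)
  rw [hμ, Measure.compProd_apply hmeas]
  refine (lintegral_congr fun ω => ?_).trans lintegral_zero
  rw [Kernel.withDensity_apply' κ hf]
  have hm : MeasurableSet (Prod.mk ω ⁻¹' {p : Ω × ℝ≥0∞ | f p.1 p.2 = 0}) :=
    measurable_prodMk_left hmeas
  exact setLIntegral_eq_zero hm fun v hv => hv

/-- Restrictions to `[0, t]` of measures whose distribution functions are measurable up to time `t`
depend measurably on the parameter. -/
theorem measurable_restrict_Iic {Ω : Type*} [MeasurableSpace Ω] (ν : Ω → Measure ℝ≥0∞)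
    [∀ ω, IsFiniteMeasure (ν ω)] (t : ℝ≥0∞)
    (h : ∀ u ≤ t, Measurable fun ω => ν ω (Set.Iic u)) :
    Measurable fun ω => (ν ω).restrict (Set.Iic t) := by
  refine Measurable.measure_of_isPiSystem (S := Set.range Set.Iic)
    (by rw [← borel_eq_generateFrom_Iic, ← BorelSpace.measurable_eq]) isPiSystem_Iic ?_ ?_
  · rintro _ ⟨u, rfl⟩
    simp_rw [Measure.restrict_apply measurableSet_Iic, Set.Iic_inter_Iic]
    exact h _ inf_le_right
  · simpa using h t le_rfl

/-- If `φ` is an extended-valued function such that `φ.toReal` is a version of the conditional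
probability of `E`, then `φ` integrates to the probability of `E` over the part of each
conditioning event where `φ` is finite. -/
theorem setLIntegral_eq_measure_inter_of_toReal_condExp {Ω : Type*} {m m0 : MeasurableSpace Ω}
    (hm : m ≤ m0) (Q : Measure Ω) [IsProbabilityMeasure Q] {E G : Set Ω}
    (hE : MeasurableSet E) (hG : MeasurableSet[m] G) (φ : Ω → ℝ≥0∞) (hφ : ∀ ω ∈ G, φ ω ≠ ∞)
    (h : (fun ω => (φ ω).toReal) =ᵐ[Q] Q[E.indicator (fun _ => (1 : ℝ)) | m]) :
    ∫⁻ ω in G, φ ω ∂Q = Q (G ∩ E) := by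
  have hint : Integrable (E.indicator fun _ => (1 : ℝ)) Q := (integrable_const _).indicator hE
  have hr := ae_restrict_of_ae (s := G) h
  calc ∫⁻ ω in G, φ ω ∂Q
      = ∫⁻ ω in G, ENNReal.ofReal (φ ω).toReal ∂Q :=
        setLIntegral_congr_fun (hm _ hG) fun ω hω => (ENNReal.ofReal_toReal (hφ ω hω)).symm
    _ = ENNReal.ofReal (∫ ω in G, (φ ω).toReal ∂Q) :=
        (ofReal_integral_eq_lintegral_ofReal ((integrable_condExp.congr h.symm).integrableOn)
          (ae_of_all _ fun _ => ENNReal.toReal_nonneg)).symm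
    _ = ENNReal.ofReal (∫ ω in G, E.indicator (fun _ => (1 : ℝ)) ω ∂Q) := by
        rw [integral_congr_ae hr, setIntegral_condExp hm hint hG]
    _ = Q (G ∩ E) := by
        rw [setIntegral_indicator hE]
        simp

/-- If `φ.toReal` is a version of the conditional probability of `E`, then `E` is almost surely
disjoint from the event where `φ` is infinite. -/
theorem measure_inter_top_eq_zero_of_toReal_condExp {Ω : Type*} {m m0 : MeasurableSpace Ω}
    (hm : m ≤ m0) (Q : Measure Ω) [IsProbabilityMeasure Q] {E : Set Ω}
    (hE : MeasurableSet E) (φ : Ω → ℝ≥0∞) (hφ : Measurable[m] φ)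
    (h : (fun ω => (φ ω).toReal) =ᵐ[Q] Q[E.indicator (fun _ => (1 : ℝ)) | m]) :
    Q ({ω | φ ω = ∞} ∩ E) = 0 := by
  have hG : MeasurableSet[m] {ω | φ ω = ∞} := hφ (measurableSet_singleton ∞)
  have h' : (fun ω => (({ω | φ ω = ∞}ᶜ.indicator φ ω)).toReal)
      =ᵐ[Q] Q[E.indicator (fun _ => (1 : ℝ)) | m] := by
    filter_upwards [h] with ω hω
    rw [← hω]
    by_cases hw : φ ω = ∞ <;> simp [hw]
  rw [← setLIntegral_eq_measure_inter_of_toReal_condExp hm Q hE hG _ ?_ h']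
  · refine setLIntegral_eq_zero (hm _ hG) fun ω hω => ?_
    simpa using fun hne => absurd hω hne
  · intro ω hω
    simp [show φ ω = ∞ from hω]

/-- The positivity of a conditional density along `τ`, for a fixed conditioning σ-algebra `m` and a
kernel `κ` of reference measures: if for every `u ≤ t` the integral of `f` over `[0, u]` is, up to
infinite values, a version of the conditional probability of `τ ≤ u`, then `f (·, τ) ≠ 0` almost
surely on `τ ≤ t`. -/
theorem measure_le_and_density_eq_zero {Ω : Type*} {m m0 : MeasurableSpace Ω}
    (hm : m ≤ m0) (Q : Measure Ω) [IsProbabilityMeasure Q] {τ : Ω → ℝ≥0∞} (hτ : Measurable τ)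
    (κ : @Kernel Ω ℝ≥0∞ m _) (hκ : @IsSFiniteKernel Ω ℝ≥0∞ m _ κ) (t : ℝ≥0∞)
    (f : Ω → ℝ≥0∞ → ℝ≥0∞)
    (hf : @Measurable (Ω × ℝ≥0∞) ℝ≥0∞ (m.prod inferInstance) _ (Function.uncurry f))
    (hf_top : ∀ a b, f a b ≠ ∞)
    (h : ∀ u ≤ t, (fun ω => (∫⁻ v in Set.Iic u, f ω v ∂κ ω).toReal)
      =ᵐ[Q] Q[{ω | τ ω ≤ u}.indicator (fun _ => (1 : ℝ)) | m])
    (hκt : ∀ ω, (κ ω).restrict (Set.Iic t) = κ ω) :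
    Q {ω | τ ω ≤ t ∧ f ω (τ ω) = 0} = 0 := by
  have hE : ∀ u, MeasurableSet {ω | τ ω ≤ u} := fun u => hτ measurableSet_Iic
  have hφ : ∀ u : ℝ≥0∞, Measurable[m] fun ω =>
      ∫⁻ v in Set.Iic u, f ω v ∂κ ω := fun u =>
    @Measurable.setLIntegral_kernel_prod_right _ _ m _ κ hκ _ hf _ measurableSet_Iic
  set B : Set Ω := {ω | ∫⁻ v in Set.Iic t, f ω v ∂κ ω = ∞}ᶜ with hB_def
  have hB : MeasurableSet[m] B := (hφ t (measurableSet_singleton ∞)).compl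
  have hBc : Q (Bᶜ ∩ {ω | τ ω ≤ t}) = 0 := by
    rw [hB_def, compl_compl]
    exact measure_inter_top_eq_zero_of_toReal_condExp hm Q (hE t) _ (hφ t) (h t le_rfl)
  have hX : @Measurable Ω (Ω × ℝ≥0∞) m0 (m.prod inferInstance) fun ω => (ω, τ ω) :=
    @Measurable.prodMk _ m0 _ _ m _ _ _ (measurable_id'' hm) hτ
  let μ : @Measure (Ω × ℝ≥0∞) (m.prod inferInstance) :=
    @Measure.map _ _ m0 (m.prod inferInstance) (fun ω => (ω, τ ω)) (Q.restrict {ω | τ ω ≤ t})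
  have hμ_apply : ∀ S, MeasurableSet[m.prod inferInstance] S →
      μ S = Q ({ω | (ω, τ ω) ∈ S} ∩ {ω | τ ω ≤ t}) := fun S hS => by
    rw [@Measure.map_apply _ _ m0 (m.prod inferInstance) _ _ hX S hS,
      Measure.restrict_apply (hX hS)]
    rfl
  have hμ_fin : @IsFiniteMeasure _ (m.prod inferInstance) μ :=
    @IsFiniteMeasure.mk _ (m.prod inferInstance) μ <| by
      rw [hμ_apply _ (@MeasurableSet.univ _ (m.prod inferInstance))]
      exact measure_lt_top _ _
  have hkey := @measure_zeroSet_eq_zero_of_prod_Iic Ω m ((Q.restrict B).trim hm) inferInstance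
    κ hκ f hf hf_top μ hμ_fin ?_
  · rw [hμ_apply {p | f p.1 p.2 = 0} (hf (measurableSet_singleton 0))] at hkey
    refine measure_mono_null ?_ hkey
    exact fun ω hω => ⟨hω.2, hω.1⟩
  · intro G hG u
    have hS : MeasurableSet[m.prod inferInstance] (G ×ˢ Set.Iic u) :=
      @MeasurableSet.prod _ _ m _ _ _ hG measurableSet_Iic
    have hGB : MeasurableSet[m] (G ∩ B) := @MeasurableSet.inter _ m _ _ hG hB
    have hinner : ∀ ω, ∫⁻ v in Set.Iic u, f ω v ∂κ ω
        = ∫⁻ v in Set.Iic (u ⊓ t), f ω v ∂κ ω := fun ω => by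
      conv_lhs => rw [← hκt ω]
      rw [Measure.restrict_restrict measurableSet_Iic, Set.Iic_inter_Iic]
    simp_rw [hinner]
    rw [restrict_trim hm _ hG, lintegral_trim hm (hφ _), Measure.restrict_restrict (hm _ hG),
      setLIntegral_eq_measure_inter_of_toReal_condExp hm Q (hE (u ⊓ t)) hGB _ ?_
        (h _ inf_le_right), hμ_apply _ hS]
    · refine measure_congr ?_
      filter_upwards [measure_eq_zero_iff_ae_notMem.1 hBc] with ω hω
      refine propext ?_
      change ((ω ∈ G ∧ τ ω ≤ u) ∧ τ ω ≤ t) ↔ ((ω ∈ G ∧ ω ∈ B) ∧ τ ω ≤ u ⊓ t)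
      have : τ ω ≤ t → ω ∈ B := fun ht => by_contra fun hb => hω ⟨hb, ht⟩
      rw [le_inf_iff]
      tauto
    · intro ω hω
      exact ne_top_of_le_ne_top hω.2
        (lintegral_mono_set (Set.Iic_subset_Iic.2 inf_le_right))

end

/-- Fix `t ∈ [0,∞)` and suppose the conditional distribution of `τ` is
differentiable at `t` with respect to `A` with density `p_t` (i.e. for `u ≤ t`,
`ω ↦ ∫_[0,u] p_t (ω,v) d(ν ω) v` is a version of `Q[τ ≤ u | F t]`, where `ν ω` is the
probability measure on `[0,∞]` with `ν ω [0,u] = A u ω`).  Then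
`Q {ω : τ ω ≤ t and p_t (ω, τ ω) = 0} = 0`, i.e. `Q`-almost surely `p_t (·, τ) > 0` on
the event `{τ ≤ t}`. -/
theorem density_pos_ae_on_event
    {Ω : Type*} [𝒜 : MeasurableSpace Ω]
    (Q : Measure Ω) [IsProbabilityMeasure Q]
    (F : ℝ≥0∞ → MeasurableSpace Ω) (hF_le : ∀ t, F t ≤ 𝒜) (hF_mono : Monotone F)
    (τ : Ω → ℝ≥0∞) (hτ : Measurable τ)
    (A : ℝ≥0∞ → Ω → ℝ)
    (hA_adapted : ∀ t, @Measurable Ω ℝ (F t) _ (A t))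
    (hA_mono : ∀ ω, Monotone fun t => A t ω)
    (hA_rc : ∀ ω, ∀ t : ℝ≥0∞, ContinuousWithinAt (fun s => A s ω) (Set.Ici t) t)
    (hA_mem : ∀ (t : ℝ≥0∞) (ω), t ≠ ∞ → A t ω ∈ Set.Ico (0 : ℝ) 1)
    (hA_top : ∀ ω, A ∞ ω = 1)
    (ν : Ω → Measure ℝ≥0∞) (hν_prob : ∀ ω, IsProbabilityMeasure (ν ω))
    (hν : ∀ ω, ∀ u : ℝ≥0∞, ν ω (Set.Iic u) = ENNReal.ofReal (A u ω))
    (t : ℝ≥0∞) (ht : t ≠ ∞)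
    (pt : Ω × ℝ≥0∞ → ℝ) (hpt_nonneg : ∀ p, 0 ≤ pt p)
    (hpt_meas : @Measurable (Ω × ℝ≥0∞) ℝ
      ((F t).prod (inferInstance : MeasurableSpace ℝ≥0∞)) _ pt)
    (hpt_version : ∀ u : ℝ≥0∞, u ≤ t →
      (fun ω => (∫⁻ v in Set.Iic u, ENNReal.ofReal (pt (ω, v)) ∂(ν ω)).toReal)
        =ᵐ[Q] Q[(fun ω => if τ ω ≤ u then (1 : ℝ) else 0) | F t]) :
    Q {ω | τ ω ≤ t ∧ pt (ω, τ ω) = 0} = 0 := by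
  have hm := hF_le t
  have hν_meas := @measurable_restrict_Iic Ω (F t) ν (fun ω => inferInstance) t fun u hu => by
    simp_rw [hν]
    exact ENNReal.measurable_ofReal.comp ((hA_adapted u).mono (hF_mono hu) le_rfl)
  let κ : @ProbabilityTheory.Kernel Ω ℝ≥0∞ (F t) _ :=
    @ProbabilityTheory.Kernel.mk _ _ (F t) _ (fun ω => (ν ω).restrict (Set.Iic t)) hν_meas
  have hκ : @ProbabilityTheory.IsFiniteKernel Ω ℝ≥0∞ (F t) _ κ :=
    @ProbabilityTheory.IsFiniteKernel.mk _ _ (F t) _ κ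
      ⟨1, ENNReal.one_lt_top, fun ω => (Measure.restrict_apply_le _ _).trans prob_le_one⟩
  have hmain := measure_le_and_density_eq_zero hm Q hτ κ
    (@ProbabilityTheory.Kernel.IsFiniteKernel.isSFiniteKernel _ _ (F t) _ κ hκ) t
    (fun ω v => ENNReal.ofReal (pt (ω, v))) (ENNReal.measurable_ofReal.comp hpt_meas)
    (fun _ _ => ENNReal.ofReal_ne_top) ?_ ?_
  · refine measure_mono_null ?_ hmain
    exact fun ω hω => ⟨hω.1, ENNReal.ofReal_eq_zero.2 hω.2.le⟩
  · intro u hu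
    have hcond : ({ω | τ ω ≤ u}.indicator fun _ => (1 : ℝ))
        = fun ω => if τ ω ≤ u then 1 else 0 := by
      ext ω
      simp [Set.indicator_apply]
    have hrestr : ∀ ω, ((ν ω).restrict (Set.Iic t)).restrict (Set.Iic u)
        = (ν ω).restrict (Set.Iic u) := fun ω => by
      rw [Measure.restrict_restrict measurableSet_Iic, Set.Iic_inter_Iic, inf_eq_left.2 hu]
    rw [hcond]
    refine Filter.EventuallyEq.trans (Filter.Eventually.of_forall fun ω => ?_) (hpt_version u hu)
    exact congrArg (fun ρ => (∫⁻ v, ENNReal.ofReal (pt (ω, v)) ∂ρ).toReal) (hrestr ω)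
  · intro ω
    change ((ν ω).restrict (Set.Iic t)).restrict (Set.Iic t) = (ν ω).restrict (Set.Iic t)
    rw [Measure.restrict_restrict measurableSet_Iic, Set.inter_self]
end

section
/- Let μ be the Lebesgue–Stieltjes measure on [0,∞) of a right-continuous nondecreasing function A : [0,∞) → [0,∞) (so μ([0,u]) = A(u), including a possible atom of mass A(0) at 0). Let p₁,…,p_k : [0,∞) → [0,∞) be Borel measurable and locally μ-integrable, and set f_j(u) = ∫_{[0,u]} p_j dμ; assume f_j(u) ∈ [0,1] for all u and all j. Let C : ℝ^k → ℝ be continuously differentiable with C(0,…,0) = 0. Then there exists a Borel measurable function ξ : [0,∞) → ℝ, locally μ-integrable, such that for every u ∈ [0,∞), C(f₁(u),…,f_k(u)) = ∫_{[0,u]} ξ dμ. -/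
open MeasureTheory
open scoped NNReal ENNReal

section StieltjesDensity

open Set Filter Topology

lemma sigmaFinite_of_measure_Iic_ne_top {μ : Measure ℝ≥0} (hμ : ∀ u, μ (Iic u) ≠ ∞) :
    SigmaFinite μ :=
  ⟨⟨{ set := fun n : ℕ => Iic (n : ℝ≥0)
      set_mem := fun _ => trivial
      finite := fun n => (hμ n).lt_top
      spanning := by
        ext x
        simpa using exists_nat_ge x }⟩⟩

lemma ext_of_measure_Iic {μ ν : Measure ℝ≥0} (hμ : ∀ u, μ (Iic u) ≠ ∞)
    (h : ∀ u, μ (Iic u) = ν (Iic u)) : μ = ν := by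
  refine Measure.ext_of_generateFrom_of_iUnion (range Iic) (fun n : ℕ => Iic (n : ℝ≥0))
    ?_ isPiSystem_Iic ?_ (fun n => ⟨_, rfl⟩) (fun n => hμ n) ?_
  · rw [BorelSpace.measurable_eq (α := ℝ≥0), borel_eq_generateFrom_Iic]
  · ext x
    simpa using exists_nat_ge x
  · rintro _ ⟨u, rfl⟩
    exact h u

/-- A nonnegative, nondecreasing, right-continuous function on `[0,∞)` is the distribution
function of a measure, with an atom at `0` if it does not vanish there. -/
lemma exists_measure_Iic_eq_ofReal {H : ℝ≥0 → ℝ} (hmono : Monotone H)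
    (hrc : ∀ u, ContinuousWithinAt H (Ici u) u) (h0 : 0 ≤ H 0) :
    ∃ ρ : Measure ℝ≥0, ∀ u, ρ (Iic u) = ENNReal.ofReal (H u) := by
  let S : StieltjesFunction ℝ≥0 := ⟨H, hmono, hrc⟩
  have hS : Tendsto S atBot (𝓝 (H 0)) := by
    rw [atBot_eq_pure_of_isBot (isBot_bot (α := ℝ≥0))]
    exact tendsto_pure_nhds S ⊥
  refine ⟨S.measure + ENNReal.ofReal (H 0) • Measure.dirac 0, fun u => ?_⟩
  have hu : S u = H u := rfl
  simp only [Measure.coe_add, Measure.coe_smul, Pi.add_apply, Pi.smul_apply, smul_eq_mul]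
  rw [S.measure_Iic hS, Measure.dirac_apply_of_mem (by simp), mul_one, hu,
    ← ENNReal.ofReal_add (sub_nonneg.2 (hmono zero_le)) h0, sub_add_cancel]

lemma continuousWithinAt_measureReal_Iic {ν : Measure ℝ≥0} (hν : ∀ u, ν (Iic u) ≠ ∞) (u : ℝ≥0) :
    ContinuousWithinAt (fun v => ν.real (Iic v)) (Ici u) u := by
  rw [← continuousWithinAt_Ioi_iff_Ici]
  have h := tendsto_measure_biInter_gt (μ := ν) (s := fun v : ℝ≥0 => Iic v) (a := u)
    (fun _ _ => measurableSet_Iic.nullMeasurableSet) (fun _ _ _ hij => Iic_subset_Iic.2 hij)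
    ⟨u + 1, by simp, hν _⟩
  have hI : (⋂ r > u, Iic r) = Iic u := by
    ext x
    simp only [mem_iInter, mem_Iic]
    exact ⟨fun hx => le_of_forall_gt_imp_ge_of_dense hx, fun hx r hr => hx.trans hr.le⟩
  rw [hI] at h
  exact (ENNReal.tendsto_toReal (hν u)).comp h

lemma exists_setIntegral_Iic_eq_measureReal {μ ρ : Measure ℝ≥0} (hμ : ∀ u, μ (Iic u) ≠ ∞)
    (hρ : ∀ u, ρ (Iic u) ≠ ∞) (hac : ρ ≪ μ) :
    ∃ ξ : ℝ≥0 → ℝ, Measurable ξ ∧ (∀ u, IntegrableOn ξ (Iic u) μ) ∧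
      ∀ u, ρ.real (Iic u) = ∫ v in Iic u, ξ v ∂μ := by
  have := sigmaFinite_of_measure_Iic_ne_top hμ
  have := sigmaFinite_of_measure_Iic_ne_top hρ
  refine ⟨fun x => (ρ.rnDeriv μ x).toReal, (Measure.measurable_rnDeriv _ _).ennreal_toReal,
    fun u => ?_, fun u => (Measure.setIntegral_toReal_rnDeriv hac _).symm⟩
  refine integrable_toReal_of_lintegral_ne_top (Measure.measurable_rnDeriv _ _).aemeasurable ?_
  rw [Measure.setLIntegral_rnDeriv hac]
  exact hρ u

/-- A function on `[0,∞)` whose increments are dominated by those of the distribution function of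
a measure `ν ≪ μ` has a locally integrable density with respect to `μ`. -/
lemma exists_density_of_abs_sub_le {μ ν : Measure ℝ≥0} (hμ : ∀ u, μ (Iic u) ≠ ∞)
    (hν : ∀ u, ν (Iic u) ≠ ∞) (hac : ν ≪ μ) {F : ℝ≥0 → ℝ}
    (hF : ∀ u v, u ≤ v → |F v - F u| ≤ ν.real (Iic v) - ν.real (Iic u))
    (hF0 : |F 0| ≤ ν.real (Iic 0)) :
    ∃ ξ : ℝ≥0 → ℝ, Measurable ξ ∧ (∀ u, IntegrableOn ξ (Iic u) μ) ∧
      ∀ u, F u = ∫ v in Iic u, ξ v ∂μ := by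
  have hGrc := continuousWithinAt_measureReal_Iic hν
  have hFrc : ∀ u, ContinuousWithinAt F (Ici u) u := fun u => by
    have h0 : Tendsto (fun v => ν.real (Iic v) - ν.real (Iic u)) (𝓝[≥] u) (𝓝 0) := by
      simpa using (hGrc u).tendsto.sub_const (ν.real (Iic u))
    have h1 : Tendsto (fun v => F v - F u) (𝓝[≥] u) (𝓝 0) := by
      refine squeeze_zero_norm' ?_ h0
      filter_upwards [self_mem_nhdsWithin] with v hv using hF u v hv
    simpa [ContinuousWithinAt] using h1.add_const (F u)
  have hpm : Monotone (fun u => ν.real (Iic u) + F u) := fun u v huv => by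
    have := (abs_le.1 (hF u v huv)).1
    dsimp only
    linarith
  have hmm : Monotone (fun u => ν.real (Iic u) - F u) := fun u v huv => by
    have := (abs_le.1 (hF u v huv)).2
    dsimp only
    linarith
  have hp0 : 0 ≤ ν.real (Iic 0) + F 0 := by linarith [(abs_le.1 hF0).1]
  have hm0 : 0 ≤ ν.real (Iic 0) - F 0 := by linarith [(abs_le.1 hF0).2]
  obtain ⟨ρ, hρ⟩ := exists_measure_Iic_eq_ofReal hpm (fun u => (hGrc u).add (hFrc u)) hp0
  obtain ⟨σ, hσ⟩ := exists_measure_Iic_eq_ofReal hmm (fun u => (hGrc u).sub (hFrc u)) hm0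
  have hsum : ρ + σ = ν + ν := by
    refine ext_of_measure_Iic (fun u => by simp [hρ, hσ]) (fun u => ?_)
    simp only [Measure.coe_add, Pi.add_apply, hρ, hσ]
    rw [← ENNReal.ofReal_add (hp0.trans (hpm zero_le)) (hm0.trans (hmm zero_le)),
      ← ofReal_measureReal (hν u), ← ENNReal.ofReal_add measureReal_nonneg measureReal_nonneg]
    congr 1
    ring
  have hρac : ρ ≪ μ := by
    refine (Measure.absolutelyContinuous_of_le (Measure.le_add_right le_rfl :
      ρ ≤ ρ + σ)).trans ?_
    rw [hsum]
    exact hac.add_left hac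
  obtain ⟨ξ, hξm, hξi, hξ⟩ := exists_setIntegral_Iic_eq_measureReal hμ (by simp [hρ]) hρac
  obtain ⟨η, hηm, hηi, hη⟩ := exists_setIntegral_Iic_eq_measureReal hμ hν hac
  refine ⟨fun v => ξ v - η v, hξm.sub hηm, fun u => (hξi u).sub (hηi u), fun u => ?_⟩
  rw [integral_sub (hξi u) (hηi u), ← hξ, ← hη, measureReal_def, hρ,
    ENNReal.toReal_ofReal (hp0.trans (hpm zero_le))]
  ring

end StieltjesDensity

/-- Let `μ` be the Lebesgue–Stieltjes measure on `[0,∞)` of a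
right-continuous nondecreasing `A : [0,∞) → [0,∞)` (so `μ [0,u] = A u`, including a
possible atom of mass `A 0` at `0`).  Let `p 1, …, p k : [0,∞) → [0,∞)` be Borel
measurable and locally `μ`-integrable, set `f j u = ∫_[0,u] p j dμ` and assume
`f j u ∈ [0,1]`.  Let `C : ℝ^k → ℝ` be continuously differentiable with `C 0 = 0`.
Then there is a Borel measurable, locally `μ`-integrable `ξ : [0,∞) → ℝ` such that
`C (f 1 u, …, f k u) = ∫_[0,u] ξ dμ` for all `u`. -/
theorem copula_composition_has_density
    (A : ℝ≥0 → ℝ≥0) (hA_mono : Monotone A)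
    (hA_rc : ∀ u : ℝ≥0, ContinuousWithinAt A (Set.Ici u) u)
    (μ : Measure ℝ≥0) (hμ : ∀ u : ℝ≥0, μ (Set.Iic u) = (A u : ℝ≥0∞))
    {k : ℕ} (p : Fin k → ℝ≥0 → ℝ)
    (hp_nonneg : ∀ j v, 0 ≤ p j v)
    (hp_meas : ∀ j, Measurable (p j))
    (hp_int : ∀ j, ∀ u : ℝ≥0, IntegrableOn (p j) (Set.Iic u) μ)
    (f : Fin k → ℝ≥0 → ℝ)
    (hf : ∀ j, ∀ u : ℝ≥0, f j u = ∫ v in Set.Iic u, p j v ∂μ)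
    (hf_mem : ∀ j, ∀ u : ℝ≥0, f j u ∈ Set.Icc (0 : ℝ) 1)
    (C : (Fin k → ℝ) → ℝ) (hC : ContDiff ℝ 1 C) (hC0 : C 0 = 0) :
    ∃ ξ : ℝ≥0 → ℝ, Measurable ξ ∧ (∀ u : ℝ≥0, IntegrableOn ξ (Set.Iic u) μ) ∧
      ∀ u : ℝ≥0, C (fun j => f j u) = ∫ v in Set.Iic u, ξ v ∂μ := by
  have hμ' : ∀ u, μ (Set.Iic u) ≠ ∞ := fun u => by simp [hμ]
  obtain ⟨L, hL⟩ : ∃ L, LipschitzOnWith L C (Set.Icc 0 1) :=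
    (hC.locallyLipschitz.locallyLipschitzOn (s := Set.Icc 0 1)).exists_lipschitzOnWith_of_compact
      isCompact_Icc
  have hfI : ∀ u, (fun j => f j u) ∈ Set.Icc (0 : Fin k → ℝ) 1 := fun u =>
    ⟨fun j => (hf_mem j u).1, fun j => (hf_mem j u).2⟩
  have hLip : ∀ x ∈ Set.Icc (0 : Fin k → ℝ) 1, ∀ y ∈ Set.Icc (0 : Fin k → ℝ) 1, x ≤ y →
      |C y - C x| ≤ L * ∑ j, (y j - x j) := fun x hx y hy hxy => by
    have h0 : ∀ j, 0 ≤ y j - x j := fun j => sub_nonneg.2 (hxy j)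
    refine (hL.norm_sub_le hy hx).trans (mul_le_mul_of_nonneg_left ?_ L.2)
    refine (pi_norm_le_iff_of_nonneg (Finset.sum_nonneg fun j _ => h0 j)).2 fun j => ?_
    rw [Pi.sub_apply, Real.norm_of_nonneg (h0 j)]
    exact Finset.single_le_sum (f := fun j => y j - x j) (fun j _ => h0 j) (Finset.mem_univ j)
  have hf_mono : ∀ j, Monotone (f j) := fun j u v huv => by
    rw [hf, hf]
    exact setIntegral_mono_set (hp_int j v) (Filter.Eventually.of_forall (hp_nonneg j))
      (Set.Iic_subset_Iic.2 huv).eventuallyLE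
  let g : ℝ≥0 → ℝ := fun v => L * ∑ j, p j v
  have hg : ∀ v, 0 ≤ g v := fun v => mul_nonneg L.2 (Finset.sum_nonneg fun j _ => hp_nonneg j v)
  have hgi : ∀ u, IntegrableOn g (Set.Iic u) μ := fun u =>
    (integrable_finsetSum _ fun j _ => hp_int j u).const_mul _
  have hgint : ∀ u, ∫ v in Set.Iic u, g v ∂μ = L * ∑ j, f j u := fun u => by
    simp only [g, hf]
    rw [integral_const_mul, integral_finsetSum _ fun j _ => hp_int j u]
  have hν : ∀ u, μ.withDensity (fun v => ENNReal.ofReal (g v)) (Set.Iic u) =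
      ENNReal.ofReal (L * ∑ j, f j u) := fun u => by
    rw [withDensity_apply _ measurableSet_Iic, ← hgint,
      ofReal_integral_eq_lintegral_ofReal (hgi u) (Filter.Eventually.of_forall hg)]
  have hνr : ∀ u, (μ.withDensity (fun v => ENNReal.ofReal (g v))).real (Set.Iic u) =
      L * ∑ j, f j u := fun u => by
    rw [measureReal_def, hν]
    exact ENNReal.toReal_ofReal
      (mul_nonneg L.2 (Finset.sum_nonneg fun j _ => (hf_mem j u).1))
  refine exists_density_of_abs_sub_le hμ' (fun u => (hν u).trans_ne ENNReal.ofReal_ne_top)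
    (withDensity_absolutelyContinuous _ _) (fun u v huv => ?_) ?_
  · rw [hνr, hνr, ← mul_sub, ← Finset.sum_sub_distrib]
    exact hLip _ (hfI u) _ (hfI v) fun j => hf_mono j huv
  · rw [hνr]
    simpa [hC0] using hLip 0 ⟨le_rfl, zero_le_one⟩ _ (hfI 0) (hfI 0).1
end
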